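/- arXiv:1409.4350 — 2 statements merged into one kernel-verified Lean document; each statement's English description precedes it below -/
import Mathlib

section
/- (Compactness for the quadratic limit.) Let ω > 0 and let α_n, β_n > 0 satisfy β_n → 0, α_n → ∞, α_n·β_n → ω. Let x_n ∈ W^{1,1}(0,T) be a sequence such that J_{α_n,β_n}(x_n) ≤ C and E(x_n(0),0) + ∫₀ᵀ ∂_t E(x_n(s),s) ds ≤ C for all n and some constant C. Then the family {ẋ_n} is uniformly integrable on (0,T), and hence there exist a subsequence (n_k) and g ∈ L¹(0,T) such that ∫₀ᵀ ẋ_{n_k}·φ → ∫₀ᵀ g·φ for every φ ∈ L^∞(0,T). -/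
open MeasureTheory Real Filter Topology Set

/-- `ψ_{α,β}(v)`, the dissipation potential from Kramers' rates. -/
noncomputable def psi (a b v : ℝ) : ℝ :=
  v / b * Real.log ((v + Real.sqrt (v ^ 2 + 4 * a ^ 2)) / (2 * a))
    - 1 / b * Real.sqrt (v ^ 2 + 4 * a ^ 2) + 2 * a / b

/-- `ψ*_{α,β}(w)`, the dual dissipation potential. -/
noncomputable def psiStar (a b w : ℝ) : ℝ :=
  2 * a / b * (Real.cosh (b * w) - 1)

open scoped ENNReal

/-- The Fenchel–Young inequality for the pair `psi`, `psiStar`. -/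
theorem mul_sub_psiStar_le_psi {a b : ℝ} (ha : 0 < a) (hb : 0 < b) (v l : ℝ) :
    l * v - psiStar a b l ≤ psi a b v := by
  unfold psi psiStar
  set s := Real.sqrt (v ^ 2 + 4 * a ^ 2) with hs
  have hs2 : s ^ 2 = v ^ 2 + 4 * a ^ 2 := Real.sq_sqrt (by positivity)
  have hvs : |v| < s := by
    rw [hs, ← Real.sqrt_sq_eq_abs]
    exact Real.sqrt_lt_sqrt (sq_nonneg v) (by nlinarith [sq_pos_of_pos ha])
  have hp : 0 < v + s := by linarith [neg_abs_le v]
  have hm : 0 < s - v := by linarith [le_abs_self v]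
  set u := Real.log ((v + s) / (2 * a)) with hu
  have hexp : Real.exp u = (v + s) / (2 * a) := Real.exp_log (by positivity)
  have hexpn : Real.exp (-u) = (s - v) / (2 * a) := by
    rw [Real.exp_neg, hexp, inv_div, div_eq_div_iff hp.ne' (by positivity)]
    linarith
  have h1 : (v + s) / (2 * a) * (1 + (b * l - u)) ≤ Real.exp (b * l) := by
    calc _ ≤ Real.exp u * Real.exp (b * l - u) := by
          rw [hexp]; gcongr; linarith [Real.add_one_le_exp (b * l - u)]
      _ = _ := by rw [← Real.exp_add]; ring_nf
  have h2 : (s - v) / (2 * a) * (1 - (b * l - u)) ≤ Real.exp (-(b * l)) := by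
    calc _ ≤ Real.exp (-u) * Real.exp (-(b * l - u)) := by
          rw [hexpn]; gcongr; linarith [Real.add_one_le_exp (-(b * l - u))]
      _ = _ := by rw [← Real.exp_add]; ring_nf
  have hcosh : s + v * (b * l - u) ≤ 2 * a * Real.cosh (b * l) := by
    rw [Real.cosh_eq]
    have h3 := mul_le_mul_of_nonneg_left (add_le_add h1 h2) ha.le
    have h4 : a * ((v + s) / (2 * a) * (1 + (b * l - u)) + (s - v) / (2 * a) * (1 - (b * l - u)))
        = s + v * (b * l - u) := by field_simp; ring
    linarith
  have key : 0 ≤ (2 * a * Real.cosh (b * l) - (s + v * (b * l - u))) / b :=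
    div_nonneg (by linarith) hb.le
  have : v / b * u - 1 / b * s + 2 * a / b - (l * v - 2 * a / b * (Real.cosh (b * l) - 1))
      = (2 * a * Real.cosh (b * l) - (s + v * (b * l - u))) / b := by field_simp; ring
  linarith

theorem psiStar_nonneg {a b : ℝ} (ha : 0 < a) (hb : 0 < b) (w : ℝ) : 0 ≤ psiStar a b w :=
  mul_nonneg (by positivity) (by linarith [Real.one_le_cosh (b * w)])

theorem psiStar_neg (a b w : ℝ) : psiStar a b (-w) = psiStar a b w := by
  simp [psiStar]

theorem psiStar_le {a b : ℝ} (ha : 0 < a) (hb : 0 < b) (w : ℝ) :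
    psiStar a b w ≤ a * b * w ^ 2 * Real.exp ((b * w) ^ 2 / 2) := by
  have h1 : Real.cosh (b * w) - 1 ≤ (b * w) ^ 2 / 2 * Real.exp ((b * w) ^ 2 / 2) := by
    have h2 := Real.cosh_le_exp_half_sq (b * w)
    have h3 := Real.add_one_le_exp (-((b * w) ^ 2 / 2))
    have h4 := mul_le_mul_of_nonneg_right h3 (Real.exp_pos ((b * w) ^ 2 / 2)).le
    rw [← Real.exp_add, neg_add_cancel, Real.exp_zero] at h4
    linarith
  calc psiStar a b w ≤ 2 * a / b * ((b * w) ^ 2 / 2 * Real.exp ((b * w) ^ 2 / 2)) := by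
        unfold psiStar; gcongr
    _ = _ := by field_simp

/-- If `a n * b n` and `b n` are bounded, the dual potentials are bounded uniformly in `n`. -/
theorem exists_psiStar_le {a b : ℕ → ℝ} (ha : ∀ n, 0 < a n) (hb : ∀ n, 0 < b n) {ω β : ℝ}
    (hb0 : Tendsto b atTop (𝓝 β)) (hab : Tendsto (fun n => a n * b n) atTop (𝓝 ω)) (w : ℝ) :
    ∃ M, 0 ≤ M ∧ ∀ n, psiStar (a n) (b n) w ≤ M := by
  have hlim : Tendsto (fun n => a n * b n * w ^ 2 * Real.exp ((b n * w) ^ 2 / 2)) atTop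
      (𝓝 (ω * w ^ 2 * Real.exp ((β * w) ^ 2 / 2))) :=
    (hab.mul_const _).mul
      ((Real.continuous_exp.tendsto _).comp (((hb0.mul_const w).pow 2).div_const 2))
  obtain ⟨M, hM⟩ := hlim.bddAbove_range
  have hle : ∀ n, psiStar (a n) (b n) w ≤ M := fun n =>
    (psiStar_le (ha n) (hb n) w).trans (hM (mem_range_self n))
  exact ⟨M, (psiStar_nonneg (ha 0) (hb 0) w).trans (hle 0), hle⟩

/-- Superlinear coercivity of the integrand, for slopes `w` bounded by `R`. -/
theorem mul_abs_le_integrand {a b R : ℝ} (ha : 0 < a) (hb : 0 < b) (K v w : ℝ) (hw : |w| ≤ R) :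
    K * |v| ≤ psi a b v + psiStar a b w + v * w + psiStar a b (R + K) := by
  have h1 := mul_sub_psiStar_le_psi ha hb v (R + K)
  have h2 := mul_sub_psiStar_le_psi ha hb v (-(R + K))
  rw [psiStar_neg] at h2
  have h3 : (R + K) * |v| - psiStar a b (R + K) ≤ psi a b v := by
    rcases abs_choice v with h | h <;> rw [h] <;> linarith
  have h4 : -(R * |v|) ≤ v * w := by
    have := neg_abs_le (v * w)
    rw [abs_mul] at this
    nlinarith [mul_le_mul_of_nonneg_left hw (abs_nonneg v)]
  linarith [psiStar_nonneg ha hb w]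

section DunfordPettis

variable {X ι : Type*} [MeasurableSpace X] {μ : Measure X}

/-- Integrating a superlinear bound `K ‖v‖ ≤ F + M` over a set. -/
theorem mul_lintegral_enorm_le {v : X → ℝ} {F : X → ℝ≥0∞} {C K M : ℝ}
    (hF : ∫⁻ x, F x ∂μ ≤ ENNReal.ofReal C)
    (hv : ∀ x, ENNReal.ofReal K * ‖v x‖ₑ ≤ F x + ENNReal.ofReal M) (s : Set X) :
    ENNReal.ofReal K * ∫⁻ x in s, ‖v x‖ₑ ∂μ
      ≤ ENNReal.ofReal C + ENNReal.ofReal M * μ s := by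
  rw [← lintegral_const_mul' _ _ ENNReal.ofReal_ne_top]
  calc ∫⁻ x in s, ENNReal.ofReal K * ‖v x‖ₑ ∂μ
      ≤ ∫⁻ x in s, (F x + ENNReal.ofReal M) ∂μ := lintegral_mono fun x => hv x
    _ = ∫⁻ x in s, F x ∂μ + ENNReal.ofReal M * μ s := by
        rw [lintegral_add_right _ measurable_const, setLIntegral_const]
    _ ≤ _ := by gcongr; exact (setLIntegral_le_lintegral s F).trans hF

/-- A de la Vallée-Poussin type criterion for uniform integrability. -/
theorem unifIntegrable_of_superlinear {v : ι → X → ℝ} {F : ι → X → ℝ≥0∞} {C : ℝ}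
    (hF : ∀ i, ∫⁻ x, F i x ∂μ ≤ ENNReal.ofReal C)
    (hv : ∀ K : ℝ, ∃ M : ℝ, 0 ≤ M ∧
      ∀ i x, ENNReal.ofReal K * ‖v i x‖ₑ ≤ F i x + ENNReal.ofReal M) :
    UnifIntegrable v 1 μ := by
  intro ε hε
  obtain ⟨M, hM, hle⟩ := hv ((|C| + 1) / ε)
  refine ⟨1 / (M + 1), by positivity, fun i s hs hμs => ?_⟩
  rw [eLpNorm_one_eq_lintegral_enorm]
  simp_rw [enorm_indicator_eq_indicator_enorm]
  rw [lintegral_indicator hs]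
  have hK : 0 < (|C| + 1) / ε := by positivity
  refine (ENNReal.mul_le_mul_iff_right (ENNReal.ofReal_pos.2 hK).ne' ENNReal.ofReal_ne_top).1 ?_
  calc _ ≤ ENNReal.ofReal C + ENNReal.ofReal M * μ s := mul_lintegral_enorm_le (hF i) (hle i) s
    _ ≤ ENNReal.ofReal |C| + ENNReal.ofReal M * ENNReal.ofReal (1 / (M + 1)) := by
        gcongr; exact le_abs_self C
    _ = ENNReal.ofReal (|C| + M * (1 / (M + 1))) := by
        rw [← ENNReal.ofReal_mul hM, ENNReal.ofReal_add (abs_nonneg C) (by positivity)]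
    _ ≤ ENNReal.ofReal ((|C| + 1) / ε * ε) := by
        refine ENNReal.ofReal_le_ofReal ?_
        rw [div_mul_cancel₀ _ hε.ne', mul_one_div]
        have : M / (M + 1) ≤ 1 := (div_le_one (by positivity)).2 (by linarith)
        linarith
    _ = _ := ENNReal.ofReal_mul hK.le

theorem UnifIntegrable.exists_abs_setIntegral_le {v : ι → X → ℝ} (hv : UnifIntegrable v 1 μ)
    {ε : ℝ} (hε : 0 < ε) :
    ∃ δ : ℝ, 0 < δ ∧ ∀ i s, MeasurableSet s → μ s ≤ ENNReal.ofReal δ →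
      |∫ x in s, v i x ∂μ| ≤ ε := by
  obtain ⟨δ, hδ, h⟩ := hv hε
  refine ⟨δ, hδ, fun i s hs hμs => ?_⟩
  have h1 := h i s hs hμs
  rw [eLpNorm_one_eq_lintegral_enorm] at h1
  simp_rw [enorm_indicator_eq_indicator_enorm] at h1
  rw [lintegral_indicator hs] at h1
  have h2 := (enorm_integral_le_lintegral_enorm (μ := μ.restrict s) (v i)).trans h1
  rw [← ofReal_norm, ENNReal.ofReal_le_ofReal_iff hε.le] at h2
  exact h2

theorem abs_setIntegral_sub_le {v : X → ℝ} (hv : Integrable v μ) {s t : Set X}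
    (hs : MeasurableSet s) (ht : MeasurableSet t) :
    |∫ x in s, v x ∂μ - ∫ x in t, v x ∂μ|
      ≤ |∫ x in s \ t, v x ∂μ| + |∫ x in t \ s, v x ∂μ| := by
  have h1 := integral_inter_add_sdiff ht (hv.integrableOn (s := s))
  have h2 := integral_inter_add_sdiff hs (hv.integrableOn (s := t))
  rw [inter_comm] at h2
  rw [← h1, ← h2, add_sub_add_left_eq_sub]
  exact abs_sub _ _

/-- A uniformly integrable sequence has a subsequence along which the integrals over every
measurable set converge. -/
theorem exists_subseq_tendsto_setIntegral [IsFiniteMeasure μ] [IsSeparable μ] {v : ℕ → X → ℝ}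
    (hint : ∀ n, Integrable (v n) μ) (hv : UnifIntegrable v 1 μ) {B : ℝ}
    (hB : ∀ n, ∫ x, |v n x| ∂μ ≤ B) :
    ∃ φ : ℕ → ℕ, StrictMono φ ∧ ∀ s, MeasurableSet s →
      ∃ l, Tendsto (fun k => ∫ x in s, v (φ k) x ∂μ) atTop (𝓝 l) := by
  obtain ⟨𝒜, h𝒜c, h𝒜⟩ := exists_countable_measureDense μ
  have : Countable 𝒜 := h𝒜c.to_subtype
  have hmem : ∀ n, (fun s : 𝒜 => ∫ x in (s : Set X), v n x ∂μ) ∈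
      Set.univ.pi fun _ : 𝒜 => Set.Icc (-B) B := fun n s _ => by
    refine abs_le.1 ((abs_integral_le_integral_abs).trans ?_)
    exact (setIntegral_le_integral (hint n).abs (ae_of_all _ fun x => abs_nonneg _)).trans (hB n)
  obtain ⟨l, -, φ, hφ, hl⟩ := (isCompact_univ_pi fun _ : 𝒜 => isCompact_Icc).tendsto_subseq hmem
  rw [tendsto_pi_nhds] at hl
  refine ⟨φ, hφ, fun s hs => cauchySeq_tendsto_of_complete (Metric.cauchySeq_iff.2 fun ε hε => ?_)⟩
  obtain ⟨δ, hδ, hsmall⟩ :=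
    UnifIntegrable.exists_abs_setIntegral_le hv (show 0 < ε / 8 by positivity)
  obtain ⟨t, ht, hst⟩ := h𝒜.approx s hs (measure_ne_top μ s) δ hδ
  have hclose : ∀ n, |∫ x in s, v n x ∂μ - ∫ x in t, v n x ∂μ| ≤ ε / 4 := fun n => by
    have htm := h𝒜.measurable t ht
    have h1 := hsmall n _ (hs.diff htm) ((measure_mono subset_union_left).trans hst.le)
    have h2 := hsmall n _ (htm.diff hs) ((measure_mono subset_union_right).trans hst.le)
    linarith [abs_setIntegral_sub_le (hint n) hs htm]
  obtain ⟨N, hN⟩ := Metric.cauchySeq_iff.1 (hl ⟨t, ht⟩).cauchySeq (ε / 4) (by positivity)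
  refine ⟨N, fun m hm n hn => ?_⟩
  have h1 := hN m hm n hn
  simp only [Function.comp_apply, Real.dist_eq] at h1 ⊢
  have h2 := abs_lt.1 h1
  have h3 := abs_le.1 (hclose (φ m))
  have h4 := abs_le.1 (hclose (φ n))
  rw [abs_lt]
  constructor <;> linarith

/-- If the integrals of a uniformly integrable sequence converge over every measurable set, the
limits are the integrals of an integrable function. -/
theorem exists_integrable_tendsto_setIntegral [IsFiniteMeasure μ] {v : ℕ → X → ℝ}
    (hint : ∀ n, Integrable (v n) μ) (hv : UnifIntegrable v 1 μ)
    (hlim : ∀ s, MeasurableSet s → ∃ l, Tendsto (fun k => ∫ x in s, v k x ∂μ) atTop (𝓝 l)) :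
    ∃ g : X → ℝ, Integrable g μ ∧ ∀ s, MeasurableSet s →
      Tendsto (fun k => ∫ x in s, v k x ∂μ) atTop (𝓝 (∫ x in s, g x ∂μ)) := by
  classical
  choose! l hl using hlim
  have hsmall : ∀ ε > 0, ∃ δ : ℝ, 0 < δ ∧ ∀ s, MeasurableSet s → μ s ≤ ENNReal.ofReal δ →
      |l s| ≤ ε := fun ε hε => by
    obtain ⟨δ, hδ, h⟩ := UnifIntegrable.exists_abs_setIntegral_le hv hε
    exact ⟨δ, hδ, fun s hs hμs =>
      le_of_tendsto (hl s hs).abs (Eventually.of_forall fun k => h k s hs hμs)⟩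
  have hnull : ∀ s, MeasurableSet s → μ s = 0 → l s = 0 := fun s hs hμs =>
    tendsto_nhds_unique (hl s hs)
      (by simp [Measure.restrict_eq_zero.2 hμs])
  let ν : SignedMeasure X :=
    { measureOf' := fun s => if MeasurableSet s then l s else 0
      empty' := by simp [hnull ∅ MeasurableSet.empty measure_empty]
      not_measurable' := fun s hs => if_neg hs
      m_iUnion' := fun f hf hd => by
        simp only [hf, MeasurableSet.iUnion hf, if_true]
        refine Metric.tendsto_atTop.2 fun ε hε => ?_
        obtain ⟨δ, hδ, hsm⟩ := hsmall (ε / 2) (by positivity)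
        have htail : Tendsto (fun t : Finset ℕ => ∑' i : {i // i ∉ t}, μ (f i)) atTop (𝓝 0) :=
          ENNReal.tendsto_tsum_compl_atTop_zero (by
            rw [← measure_iUnion hd hf]; exact measure_ne_top μ _)
        obtain ⟨t₀, ht₀⟩ := eventually_atTop.1
          (htail.eventually_le_const (ENNReal.ofReal_pos.2 hδ))
        refine ⟨t₀, fun t ht => ?_⟩
        have hUm : MeasurableSet (⋃ i : {i // i ∉ t}, f i) := MeasurableSet.iUnion fun i => hf i
        have hsplit : (⋃ i, f i) = (⋃ i ∈ t, f i) ∪ ⋃ i : {i // i ∉ t}, f i := by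
          ext x
          simp only [mem_iUnion, mem_union, Subtype.exists, exists_prop]
          constructor
          · rintro ⟨i, hi⟩
            by_cases hit : i ∈ t
            exacts [Or.inl ⟨i, hit, hi⟩, Or.inr ⟨i, hit, hi⟩]
          · rintro (⟨i, -, hi⟩ | ⟨i, -, hi⟩) <;> exact ⟨i, hi⟩
        have hdisj : Disjoint (⋃ i ∈ t, f i) (⋃ i : {i // i ∉ t}, f i) := by
          simp only [disjoint_iUnion_left, disjoint_iUnion_right]
          exact fun j i hi => hd (fun h => j.2 (h ▸ hi))
        have hadd : l (⋃ i, f i) = ∑ i ∈ t, l (f i) + l (⋃ i : {i // i ∉ t}, f i) := by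
          refine tendsto_nhds_unique (hl _ (MeasurableSet.iUnion hf)) ?_
          refine ((tendsto_finsetSum t fun i _ => hl _ (hf i)).add (hl _ hUm)).congr fun k => ?_
          rw [hsplit, setIntegral_union hdisj hUm (hint k).integrableOn (hint k).integrableOn,
            integral_biUnion_finset t (fun i _ => hf i) (fun i _ j _ hij => hd hij)
              (fun i _ => (hint k).integrableOn)]
        have := hsm _ hUm ((measure_iUnion_le _).trans (ht₀ t ht))
        rw [dist_comm, Real.dist_eq, hadd, add_sub_cancel_left]
        linarith }
  have hν : ∀ s, MeasurableSet s → ν s = l s := fun s hs => if_pos hs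
  have hac : ν ≪ᵥ μ.toENNRealVectorMeasure := by
    refine VectorMeasure.AbsolutelyContinuous.mk fun s hs hμs => ?_
    rw [Measure.toENNRealVectorMeasure_apply_measurable hs] at hμs
    rw [hν s hs, hnull s hs hμs]
  have hgint := SignedMeasure.integrable_rnDeriv ν μ
  refine ⟨ν.rnDeriv μ, hgint, fun s hs => ?_⟩
  rw [← withDensityᵥ_apply hgint hs, SignedMeasure.withDensityᵥ_rnDeriv_eq ν μ hac, hν s hs]
  exact hl s hs

/-- Bounded measurable functions are uniform limits of simple functions. -/
theorem exists_simpleFunc_abs_sub_le {f : X → ℝ} (hf : Measurable f) {M : ℝ}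
    (hM : ∀ x, |f x| ≤ M) {ε : ℝ} (hε : 0 < ε) :
    ∃ h : SimpleFunc X ℝ, ∀ x, |f x - h x| ≤ ε := by
  have hmeas : Measurable fun x => ⌊f x / ε⌋ := (hf.div_const ε).floor
  have hfin : (range fun x => ⌊f x / ε⌋).Finite := by
    refine (Set.finite_Icc ⌊-M / ε⌋ ⌊M / ε⌋).subset ?_
    rintro _ ⟨x, rfl⟩
    have := abs_le.1 (hM x)
    exact ⟨Int.floor_mono (by gcongr; exact this.1), Int.floor_mono (by gcongr; exact this.2)⟩
  let h : SimpleFunc X ℤ := ⟨fun x => ⌊f x / ε⌋, fun k => hmeas (measurableSet_singleton k), hfin⟩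
  refine ⟨h.map fun k : ℤ => ε * (k : ℝ), fun x => ?_⟩
  change |f x - ε * (⌊f x / ε⌋ : ℝ)| ≤ ε
  have h1 := Int.floor_le (f x / ε)
  have h2 := Int.lt_floor_add_one (f x / ε)
  rw [le_div_iff₀ hε] at h1
  rw [div_lt_iff₀ hε] at h2
  rw [abs_le]
  constructor <;> linarith

theorem integrable_mul_simpleFunc {v : X → ℝ} (hv : Integrable v μ) (h : SimpleFunc X ℝ) :
    Integrable (fun x => v x * h x) μ := by
  obtain ⟨D, hD⟩ := h.exists_forall_norm_le
  exact hv.mul_bdd (c := D) h.aestronglyMeasurable (ae_of_all _ hD)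

/-- For an `L¹`-bounded sequence, convergence of integrals over measurable sets implies
convergence against bounded measurable functions. -/
theorem tendsto_integral_mul_of_tendsto_setIntegral {v : ℕ → X → ℝ} {g : X → ℝ}
    (hint : ∀ n, Integrable (v n) μ) (hg : Integrable g μ) {B : ℝ}
    (hB : ∀ n, ∫ x, |v n x| ∂μ ≤ B)
    (hlim : ∀ s, MeasurableSet s →
      Tendsto (fun k => ∫ x in s, v k x ∂μ) atTop (𝓝 (∫ x in s, g x ∂μ)))
    {f : X → ℝ} (hf : Measurable f) {M : ℝ} (hM : ∀ x, |f x| ≤ M) :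
    Tendsto (fun k => ∫ x, v k x * f x ∂μ) atTop (𝓝 (∫ x, g x * f x ∂μ)) := by
  have hsimple : ∀ h : SimpleFunc X ℝ,
      Tendsto (fun k => ∫ x, v k x * h x ∂μ) atTop (𝓝 (∫ x, g x * h x ∂μ)) := by
    intro h
    induction h using SimpleFunc.induction with
    | const c hs =>
      rename_i s
      have key : ∀ u : X → ℝ, ∫ x, u x * (SimpleFunc.piecewise s hs (SimpleFunc.const X c)
          (SimpleFunc.const X 0)) x ∂μ = (∫ x in s, u x ∂μ) * c := fun u => by
        rw [← integral_mul_const, ← integral_indicator hs]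
        refine integral_congr_ae (ae_of_all _ fun x => ?_)
        by_cases hx : x ∈ s <;> simp [hx]
      simp_rw [key]
      exact (hlim s hs).mul_const c
    | add hd h₁ h₂ =>
      rename_i p q
      have key : ∀ u : X → ℝ, Integrable u μ → ∫ x, u x * (p + q) x ∂μ
          = ∫ x, u x * p x ∂μ + ∫ x, u x * q x ∂μ := fun u hu => by
        rw [← integral_add (integrable_mul_simpleFunc hu p) (integrable_mul_simpleFunc hu q)]
        simp [mul_add]
      rw [key g hg]
      exact (h₁.add h₂).congr fun k => (key _ (hint k)).symm
  have happrox : ∀ (u : X → ℝ), Integrable u μ → ∀ (h : SimpleFunc X ℝ) (η : ℝ),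
      (∀ x, |f x - h x| ≤ η) →
      |∫ x, u x * f x ∂μ - ∫ x, u x * h x ∂μ| ≤ (∫ x, |u x| ∂μ) * η := fun u hu h η hη => by
    have huf : Integrable (fun x => u x * f x) μ :=
      hu.mul_bdd (c := M) hf.aestronglyMeasurable (ae_of_all _ hM)
    rw [← integral_sub huf (integrable_mul_simpleFunc hu h), ← integral_mul_const,
      ← Real.norm_eq_abs]
    refine norm_integral_le_of_norm_le (hu.abs.mul_const η) (ae_of_all _ fun x => ?_)
    rw [← mul_sub, Real.norm_eq_abs, abs_mul]
    exact mul_le_mul_of_nonneg_left (hη x) (abs_nonneg _)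
  refine Metric.tendsto_atTop.2 fun ε hε => ?_
  set D := |B| + ∫ x, |g x| ∂μ + 1
  have hgn : 0 ≤ ∫ x, |g x| ∂μ := integral_nonneg fun x => abs_nonneg _
  have hDpos : 0 < D := by positivity
  have hηpos : 0 < ε / (3 * D) := by positivity
  have hDη : D * (ε / (3 * D)) = ε / 3 := by field_simp
  obtain ⟨h, hh⟩ := exists_simpleFunc_abs_sub_le hf hM hηpos
  obtain ⟨N, hN⟩ := Metric.tendsto_atTop.1 (hsimple h) (ε / 3) (by positivity)
  refine ⟨N, fun k hk => ?_⟩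
  have h1 := (happrox (v k) (hint k) h _ hh).trans (c := ε / 3) (by
    rw [← hDη]; gcongr; linarith [hB k, le_abs_self B])
  have h2 := (happrox g hg h _ hh).trans (c := ε / 3) (by
    rw [← hDη]; gcongr; linarith [abs_nonneg B])
  have h3 := hN k hk
  rw [Real.dist_eq] at h3 ⊢
  have h1' := abs_le.1 h1
  have h2' := abs_le.1 h2
  have h3' := abs_lt.1 h3
  rw [abs_lt]
  constructor <;> linarith

/-- Sequential Dunford–Pettis theorem on a separable finite measure space. -/
theorem exists_subseq_weak_tendsto [IsFiniteMeasure μ] [IsSeparable μ] {v : ℕ → X → ℝ}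
    (hint : ∀ n, Integrable (v n) μ) (hv : UnifIntegrable v 1 μ) {B : ℝ}
    (hB : ∀ n, ∫ x, |v n x| ∂μ ≤ B) :
    ∃ φ : ℕ → ℕ, StrictMono φ ∧ ∃ g : X → ℝ, Integrable g μ ∧
      ∀ f : X → ℝ, Measurable f → (∃ M, ∀ x, |f x| ≤ M) →
        Tendsto (fun k => ∫ x, v (φ k) x * f x ∂μ) atTop (𝓝 (∫ x, g x * f x ∂μ)) := by
  obtain ⟨φ, hφ, hlim⟩ := exists_subseq_tendsto_setIntegral hint hv hB
  obtain ⟨g, hg, hgl⟩ := exists_integrable_tendsto_setIntegral (fun k => hint (φ k))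
    (fun ε hε => by
      obtain ⟨δ, hδ, h⟩ := hv hε
      exact ⟨δ, hδ, fun k => h (φ k)⟩) hlim
  exact ⟨φ, hφ, g, hg, fun f hf ⟨M, hM⟩ => tendsto_integral_mul_of_tendsto_setIntegral
    (fun k => hint (φ k)) hg (fun k => hB (φ k)) hgl hf hM⟩

end DunfordPettis

/-- compactness for the quadratic limit: let `β_n → 0`, `α_n → ∞`,
`α_n β_n → ω > 0`, and let `x_n ∈ W^{1,1}(0,T)` satisfy `J_{α_n,β_n}(x_n) ≤ C` and
`E(x_n(0),0) + ∫₀ᵀ ∂_t E(x_n(s),s) ds ≤ C` for all `n`.  Then the derivatives `ẋ_n` are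
uniformly integrable on `(0,T)`, and there are a subsequence `(n_k)` and `g ∈ L¹(0,T)`
such that `∫₀ᵀ ẋ_{n_k} φ → ∫₀ᵀ g φ` for every `φ ∈ L^∞(0,T)`. -/
theorem quadratic_compactness
    (T : ℝ) (hT : 0 < T)
    -- the energy `E`, spatial derivative `∇E = DE`, time derivative `∂_t E = Et`
    (E DE Et : ℝ → ℝ → ℝ) (R L : ℝ)
    (hEcont : Continuous fun p : ℝ × ℝ => E p.1 p.2)
    (hDEcont : Continuous fun p : ℝ × ℝ => DE p.1 p.2)
    (hEtcont : Continuous fun p : ℝ × ℝ => Et p.1 p.2)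
    (hDE : ∀ y t, HasDerivAt (fun z => E z t) (DE y t) y)
    (hEt : ∀ y t, HasDerivAt (fun τ => E y τ) (Et y t) t)
    (hEnonneg : ∀ y t, 0 ≤ E y t)
    (hDEbound : ∀ y t, |DE y t| ≤ R)
    (hDELip : ∀ y s t, |DE y t - DE y s| ≤ L * |t - s|)
    -- the scaling regime
    (ω : ℝ) (hω : 0 < ω)
    (a b : ℕ → ℝ) (ha : ∀ n, 0 < a n) (hb : ∀ n, 0 < b n)
    (hb0 : Tendsto b atTop (𝓝 0)) (hainf : Tendsto a atTop atTop)
    (hab : Tendsto (fun n => a n * b n) atTop (𝓝 ω))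
    -- the curves `x_n` in `W^{1,1}(0,T)`
    (xn xn' : ℕ → ℝ → ℝ)
    (hxn'int : ∀ n, IntegrableOn (xn' n) (Set.Ioo 0 T))
    (hxnac : ∀ n, ∀ t ∈ Set.Icc 0 T, xn n t = xn n 0 + ∫ s in (0:ℝ)..t, xn' n s)
    (hEtint : ∀ n, IntegrableOn (fun s => Et (xn n s) s) (Set.Ioo 0 T))
    -- the uniform bounds
    (C : ℝ)
    (hJ : ∀ n, (∫⁻ t in Set.Ioo 0 T, ENNReal.ofReal
        (psi (a n) (b n) (xn' n t) + psiStar (a n) (b n) (DE (xn n t) t)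
          + xn' n t * DE (xn n t) t)) ≤ ENNReal.ofReal C)
    (hEbound : ∀ n, E (xn n 0) 0 + (∫ s in Set.Ioo 0 T, Et (xn n s) s) ≤ C) :
    UnifIntegrable (fun n => xn' n) 1 (volume.restrict (Set.Ioo 0 T)) ∧
    ∃ φ : ℕ → ℕ, StrictMono φ ∧ ∃ g : ℝ → ℝ, IntegrableOn g (Set.Ioo 0 T) ∧
      ∀ f : ℝ → ℝ, Measurable f → (∃ M, ∀ t, |f t| ≤ M) →
        Tendsto (fun k => ∫ t in Set.Ioo 0 T, xn' (φ k) t * f t) atTop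
          (𝓝 (∫ t in Set.Ioo 0 T, g t * f t)) := by
  have hcoer : ∀ K : ℝ, ∃ M : ℝ, 0 ≤ M ∧ ∀ n t, ENNReal.ofReal K * ‖xn' n t‖ₑ ≤
      ENNReal.ofReal (psi (a n) (b n) (xn' n t) + psiStar (a n) (b n) (DE (xn n t) t)
        + xn' n t * DE (xn n t) t) + ENNReal.ofReal M := fun K => by
    obtain ⟨M, hM, hle⟩ := exists_psiStar_le ha hb hb0 hab (R + K)
    refine ⟨M, hM, fun n t => ?_⟩
    rw [← ofReal_norm, ← ENNReal.ofReal_mul' (norm_nonneg _)]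
    refine (ENNReal.ofReal_le_ofReal ?_).trans ENNReal.ofReal_add_le
    rw [Real.norm_eq_abs]
    linarith [mul_abs_le_integrand (ha n) (hb n) K (xn' n t) _ (hDEbound (xn n t) t), hle n]
  have hUI : UnifIntegrable (fun n => xn' n) 1 (volume.restrict (Set.Ioo 0 T)) :=
    unifIntegrable_of_superlinear hJ hcoer
  obtain ⟨M, hM, hle⟩ := hcoer 1
  have hB : ∀ n, ∫ t in Set.Ioo 0 T, |xn' n t| ≤
      (ENNReal.ofReal C + ENNReal.ofReal M * volume.restrict (Set.Ioo 0 T) univ).toReal :=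
    fun n => by
      have h := mul_lintegral_enorm_le (hJ n) (hle n) univ
      rw [ENNReal.ofReal_one, one_mul, setLIntegral_univ] at h
      simp_rw [← Real.norm_eq_abs]
      rw [integral_norm_eq_lintegral_enorm (hxn'int n).aestronglyMeasurable]
      exact ENNReal.toReal_mono (ENNReal.add_ne_top.2 ⟨ENNReal.ofReal_ne_top,
        ENNReal.mul_ne_top ENNReal.ofReal_ne_top (measure_ne_top _ _)⟩) h
  exact ⟨hUI, exists_subseq_weak_tendsto hxn'int hUI hB⟩
end

section
/- (Perspective infimum identity.) Let α, β > 0 and let v > 0, c > 0. Then inf_{ε > 0} [ ε·ψ_{α,β}(v/ε) + ε·ψ*_{α,β}(c) ] = v·c, and the infimum is attained at ε = v/(2α·sinh(βc)). -/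
open Real Filter Topology Set

/-- The parametrisation `v = 2 α sinh t` linearises the logarithm in `ψ_{α,β}`. -/
theorem psi_two_mul_sinh {a : ℝ} (ha : 0 < a) (b t : ℝ) :
    psi a b (2 * a * Real.sinh t) =
      2 * a / b * (t * Real.sinh t - Real.cosh t + 1) := by
  have hsqrt : Real.sqrt ((2 * a * Real.sinh t) ^ 2 + 4 * a ^ 2) = 2 * a * Real.cosh t := by
    have h : (2 * a * Real.sinh t) ^ 2 + 4 * a ^ 2 = (2 * a * Real.cosh t) ^ 2 := by
      rw [mul_pow _ (Real.cosh t), Real.cosh_sq]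
      ring
    rw [h, Real.sqrt_sq (by positivity)]
  have hexp : (2 * a * Real.sinh t + 2 * a * Real.cosh t) / (2 * a) = Real.exp t := by
    rw [← mul_add, Real.sinh_add_cosh, mul_div_cancel_left₀ _ (by positivity)]
  rw [psi, hsqrt, hexp, Real.log_exp]
  ring

/-- The graph of `cosh` lies above its tangent lines. -/
theorem cosh_add_sinh_mul_sub_le_cosh (s t : ℝ) :
    Real.cosh t + Real.sinh t * (s - t) ≤ Real.cosh s := by
  have hpos : Real.exp t * (1 + (s - t)) ≤ Real.exp s := by
    calc Real.exp t * (1 + (s - t)) ≤ Real.exp t * Real.exp (s - t) := by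
          gcongr
          linarith [Real.add_one_le_exp (s - t)]
      _ = Real.exp s := by rw [← Real.exp_add]; congr 1; ring
  have hneg : Real.exp (-t) * (1 - (s - t)) ≤ Real.exp (-s) := by
    calc Real.exp (-t) * (1 - (s - t)) ≤ Real.exp (-t) * Real.exp (-(s - t)) := by
          gcongr
          linarith [Real.add_one_le_exp (-(s - t))]
      _ = Real.exp (-s) := by rw [← Real.exp_add]; congr 1; ring
  rw [Real.cosh_eq, Real.cosh_eq, Real.sinh_eq]
  linarith

/-- Fenchel–Young inequality for the dual pair `ψ_{α,β}`, `ψ*_{α,β}`. -/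
theorem mul_le_psi_add_psiStar {a b : ℝ} (ha : 0 < a) (hb : 0 < b) (v w : ℝ) :
    v * w ≤ psi a b v + psiStar a b w := by
  obtain ⟨t, ht⟩ := Real.sinh_surjective (v / (2 * a))
  obtain rfl : v = 2 * a * Real.sinh t := by
    rw [ht]
    field_simp
  rw [psi_two_mul_sinh ha, psiStar]
  have h := mul_le_mul_of_nonneg_left (cosh_add_sinh_mul_sub_le_cosh (b * w) t)
    (by positivity : 0 ≤ 2 * a / b)
  have hw : 2 * a * Real.sinh t * w = 2 * a / b * (Real.sinh t * (b * w)) := by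
    field_simp
  rw [hw]
  linarith

/-- Equality case of the Fenchel–Young inequality. -/
theorem psi_add_psiStar_eq {a b : ℝ} (ha : 0 < a) (hb : 0 < b) (w : ℝ) :
    psi a b (2 * a * Real.sinh (b * w)) + psiStar a b w =
      2 * a * Real.sinh (b * w) * w := by
  rw [psi_two_mul_sinh ha, psiStar]
  field_simp
  ring

/-- perspective infimum identity: for `α, β > 0` and `v, c > 0`,
`inf_{ε > 0} [ε ψ_{α,β}(v/ε) + ε ψ*_{α,β}(c)] = v·c`, and the infimum is attained at
`ε = v/(2α sinh(βc))`. -/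
theorem perspective_infimum_identity
    (a b v c : ℝ) (ha : 0 < a) (hb : 0 < b) (hv : 0 < v) (hc : 0 < c) :
    IsGLB ((fun ε : ℝ => ε * psi a b (v / ε) + ε * psiStar a b c) '' Set.Ioi 0)
      (v * c) ∧
    0 < v / (2 * a * Real.sinh (b * c)) ∧
    (v / (2 * a * Real.sinh (b * c))) * psi a b (v / (v / (2 * a * Real.sinh (b * c))))
        + (v / (2 * a * Real.sinh (b * c))) * psiStar a b c = v * c := by
  have hsinh : 0 < Real.sinh (b * c) := Real.sinh_pos_iff.mpr (by positivity)
  have hpos : 0 < v / (2 * a * Real.sinh (b * c)) := by positivity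
  have hval : (v / (2 * a * Real.sinh (b * c))) *
        psi a b (v / (v / (2 * a * Real.sinh (b * c))))
      + (v / (2 * a * Real.sinh (b * c))) * psiStar a b c = v * c := by
    rw [div_div_cancel₀ hv.ne', ← mul_add, psi_add_psiStar_eq ha hb]
    field_simp
  refine ⟨IsLeast.isGLB ⟨⟨_, hpos, hval⟩, ?_⟩, hpos, hval⟩
  rintro _ ⟨ε, hε, rfl⟩
  have hε' : 0 < ε := hε
  calc v * c = ε * (v / ε * c) := by field_simp
    _ ≤ ε * (psi a b (v / ε) + psiStar a b c) := by
        gcongr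
        exact mul_le_psi_add_psiStar ha hb _ _
    _ = ε * psi a b (v / ε) + ε * psiStar a b c := mul_add _ _ _
end
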